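/- Veronese inclusions in the graded pieces of the isotypic filtration (Corollary 3.4 of the paper): In the block-diagonal Kronecker model with 0 ≤ n_1 < n_2 < … < n_k, for each j = 1,…,k and (λ1,λ2) ∈ ℝ² \ {(0,0)} let u_j(λ) ∈ ℝ^N be the vector supported in Q_j whose q-coordinates in the j-th block are the coordinates of w_{n_j}(λ1,λ2) and whose other coordinates are 0. Then for every (λ1,λ2) ∈ ℝ² \ {(0,0)}: (1) the kernel of C_λ has dimension k and equals the span of u_1(λ),…,u_k(λ); (2) setting F_j = Q_1 ⊕ … ⊕ Q_j, the subspace F_j ∩ ker C_λ has dimension j and equals the span of u_1(λ),…,u_j(λ); (3) the image of F_j ∩ ker C_λ under the coordinate projection of ℝ^N onto Q_j is the line spanned by u_j(λ); in particular, for any r ≤ n_j+1 pairwise non-proportional parameters λ^(1),…,λ^(r), the vectors u_j(λ^(1)),…,u_j(λ^(r)) are linearly independent, so λ ↦ span{u_j(λ)} defines a Veronese inclusion into the projectivization of Q_j. -/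

import Mathlib

open Matrix

noncomputable section

/-- The `n × (n+1)` matrix `B1(n)`: entries `1` on positions `(i, i)`, else `0`. -/
def kronB1 (K : Type*) [Zero K] [One K] (n : ℕ) : Matrix (Fin n) (Fin (n + 1)) K :=
  Matrix.of fun i j => if (j : ℕ) = (i : ℕ) then 1 else 0

/-- The `n × (n+1)` matrix `B2(n)`: entries `1` on positions `(i, i+1)`, else `0`. -/
def kronB2 (K : Type*) [Zero K] [One K] (n : ℕ) : Matrix (Fin n) (Fin (n + 1)) K :=
  Matrix.of fun i j => if (j : ℕ) = (i : ℕ) + 1 then 1 else 0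

/-- The first member `K1(n)` of the Kronecker block pair of dimension `2n+1`. -/
def kronK1 (K : Type*) [Zero K] [One K] [Neg K] (n : ℕ) :
    Matrix (Fin n ⊕ Fin (n + 1)) (Fin n ⊕ Fin (n + 1)) K :=
  Matrix.fromBlocks 0 (kronB1 K n) (-(kronB1 K n)ᵀ) 0

/-- The second member `K2(n)` of the Kronecker block pair of dimension `2n+1`. -/
def kronK2 (K : Type*) [Zero K] [One K] [Neg K] (n : ℕ) :
    Matrix (Fin n ⊕ Fin (n + 1)) (Fin n ⊕ Fin (n + 1)) K :=
  Matrix.fromBlocks 0 (kronB2 K n) (-(kronB2 K n)ᵀ) 0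

/-- The Veronese vector `w_n(λ1,λ2)` with coordinates `(−λ1)^{i} · λ2^{n−i}`, `i = 0,…,n`. -/
def veroneseVec (n : ℕ) (l : ℝ × ℝ) : Fin (n + 1) → ℝ :=
  fun i => (-l.1) ^ (i : ℕ) * l.2 ^ (n - (i : ℕ))

/-- Block-diagonal Kronecker model: the first matrix `C1`, with diagonal blocks
`K1(n_1), …, K1(n_k)`. -/
def blockC1 (k : ℕ) (n : Fin k → ℕ) :
    Matrix (Σ j : Fin k, Fin (n j) ⊕ Fin (n j + 1)) (Σ j : Fin k, Fin (n j) ⊕ Fin (n j + 1)) ℝ :=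
  Matrix.blockDiagonal' fun j => kronK1 ℝ (n j)

/-- Block-diagonal Kronecker model: the second matrix `C2`, with diagonal blocks
`K2(n_1), …, K2(n_k)`. -/
def blockC2 (k : ℕ) (n : Fin k → ℕ) :
    Matrix (Σ j : Fin k, Fin (n j) ⊕ Fin (n j + 1)) (Σ j : Fin k, Fin (n j) ⊕ Fin (n j + 1)) ℝ :=
  Matrix.blockDiagonal' fun j => kronK2 ℝ (n j)

/-- The coordinate subspace `Q_j` spanned by the q-coordinates of the `j`-th Kronecker block. -/
def blockQ (k : ℕ) (n : Fin k → ℕ) (j : Fin k) :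
    Submodule ℝ ((Σ j' : Fin k, Fin (n j') ⊕ Fin (n j' + 1)) → ℝ) :=
  Submodule.span ℝ (Set.range fun q : Fin (n j + 1) =>
    Pi.single (⟨j, Sum.inr q⟩ : Σ j' : Fin k, Fin (n j') ⊕ Fin (n j' + 1)) (1 : ℝ))

/-- The isotypic filtration `F_j = Q_1 ⊕ … ⊕ Q_j`. -/
def blockF (k : ℕ) (n : Fin k → ℕ) (j : Fin k) :
    Submodule ℝ ((Σ j' : Fin k, Fin (n j') ⊕ Fin (n j' + 1)) → ℝ) :=
  ⨆ (j' : Fin k) (_ : j' ≤ j), blockQ k n j'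

/-- The vector `u_j(λ) ∈ ℝ^N` supported in `Q_j`, whose q-coordinates in the `j`-th block
form the Veronese vector `w_{n_j}(λ)`. -/
def uVec (k : ℕ) (n : Fin k → ℕ) (j : Fin k) (l : ℝ × ℝ) :
    (Σ j' : Fin k, Fin (n j') ⊕ Fin (n j' + 1)) → ℝ :=
  fun x => if x.1 = j then Sum.elim (fun _ => (0 : ℝ)) (fun q => veroneseVec (n x.1) l q) x.2 else 0

/-- The coordinate projection of `ℝ^N` onto `Q_j` (killing all coordinates outside the
q-coordinates of the `j`-th block). -/
def projQ (k : ℕ) (n : Fin k → ℕ) (j : Fin k) :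
    ((Σ j' : Fin k, Fin (n j') ⊕ Fin (n j' + 1)) → ℝ) →ₗ[ℝ]
      ((Σ j' : Fin k, Fin (n j') ⊕ Fin (n j' + 1)) → ℝ) where
  toFun v := fun x => if x.1 = j ∧ x.2.isRight = true then v x else 0
  map_add' a b := by
    funext x
    by_cases h : x.1 = j ∧ x.2.isRight = true <;> simp [h]
  map_smul' c a := by
    funext x
    by_cases h : x.1 = j ∧ x.2.isRight = true <;> simp [h]

/-- The pencil `λ1 B1(n) + λ2 B2(n)`. -/
def kronPencil (n : ℕ) (l : ℝ × ℝ) : Matrix (Fin n) (Fin (n + 1)) ℝ :=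
  l.1 • kronB1 ℝ n + l.2 • kronB2 ℝ n

lemma kronPencil_mulVec_apply (n : ℕ) (l : ℝ × ℝ) (q : Fin (n + 1) → ℝ) (i : Fin n) :
    (kronPencil n l *ᵥ q) i = l.1 * q i.castSucc + l.2 * q i.succ := by
  have h1 : ∀ j : Fin (n + 1), (j : ℕ) = (i : ℕ) ↔ j = i.castSucc := fun j => by
    simp [Fin.ext_iff]
  have h2 : ∀ j : Fin (n + 1), (j : ℕ) = (i : ℕ) + 1 ↔ j = i.succ := fun j => by
    simp [Fin.ext_iff]
  simp [kronPencil, mulVec, dotProduct, kronB1, kronB2, h1, h2, add_mul, Finset.sum_add_distrib]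

lemma veroneseVec_ne_zero (n : ℕ) {l : ℝ × ℝ} (hl : l ≠ 0) : veroneseVec n l ≠ 0 := by
  intro h
  have h0 := congrFun h 0
  have hn := congrFun h (Fin.last n)
  simp only [veroneseVec, Fin.val_zero, pow_zero, one_mul, Nat.sub_zero, Pi.zero_apply,
    Fin.val_last, Nat.sub_self, mul_one] at h0 hn
  exact hl (Prod.ext (neg_eq_zero.1 (eq_zero_of_pow_eq_zero hn)) (eq_zero_of_pow_eq_zero h0))

/-- Applying the pencil at `a` to a Veronese vector lowers its degree. -/
lemma kronPencil_mulVec_veroneseVec (n : ℕ) (a l : ℝ × ℝ) :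
    kronPencil (n + 1) a *ᵥ veroneseVec (n + 1) l =
      (a.1 * l.2 - a.2 * l.1) • veroneseVec n l := by
  ext i
  have h : n + 1 - (i : ℕ) = n - (i : ℕ) + 1 := by omega
  simp only [kronPencil_mulVec_apply, veroneseVec, Fin.val_castSucc, Fin.val_succ,
    Nat.add_sub_add_right, h, Pi.smul_apply, smul_eq_mul]
  ring

lemma kronPencil_mulVec_veroneseVec_self (n : ℕ) (l : ℝ × ℝ) :
    kronPencil n l *ᵥ veroneseVec n l = 0 := by
  cases n with
  | zero => exact Subsingleton.elim _ _
  | succ n =>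
    rw [kronPencil_mulVec_veroneseVec, mul_comm, sub_self, zero_smul]

lemma ker_kronPencil (n : ℕ) {l : ℝ × ℝ} (hl : l ≠ 0) :
    LinearMap.ker (kronPencil n l).mulVecLin = Submodule.span ℝ {veroneseVec n l} := by
  apply le_antisymm
  · intro q hq
    have hq' : ∀ i : Fin n, l.1 * q i.castSucc + l.2 * q i.succ = 0 := fun i => by
      rw [← kronPencil_mulVec_apply]
      exact congrFun (LinearMap.mem_ker.1 hq) i
    rw [Submodule.mem_span_singleton]
    by_cases h2 : l.2 = 0
    · have h1 : l.1 ≠ 0 := fun h1 => hl (Prod.ext h1 h2)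
      refine ⟨q (Fin.last n) / (-l.1) ^ n, ?_⟩
      ext i
      induction i using Fin.lastCases with
      | last => simp [veroneseVec, h1]
      | cast i =>
        have hi : q i.castSucc = 0 := by simpa [h1, h2] using hq' i
        have hni : n - (i : ℕ) ≠ 0 := by omega
        simp [veroneseVec, hi, h2, hni]
    · refine ⟨q 0 / l.2 ^ n, ?_⟩
      ext i
      induction i using Fin.induction with
      | zero => simp [veroneseVec, h2]
      | succ i ih =>
        have hw := kronPencil_mulVec_apply n l (veroneseVec n l) i
        rw [kronPencil_mulVec_veroneseVec_self] at hw
        simp only [Pi.zero_apply, Pi.smul_apply, smul_eq_mul] at hw ih ⊢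
        apply mul_left_cancel₀ h2
        linear_combination (-(q 0 / l.2 ^ n)) * hw - hq' i - l.1 * ih
  · rw [Submodule.span_singleton_le_iff_mem, LinearMap.mem_ker]
    exact kronPencil_mulVec_veroneseVec_self n l

lemma kronPencil_transpose_mulVec_eq_zero (n : ℕ) {l : ℝ × ℝ} (hl : l ≠ 0) {p : Fin n → ℝ}
    (hp : (kronPencil n l)ᵀ *ᵥ p = 0) : p = 0 := by
  have hsurj : Function.Surjective (kronPencil n l).mulVecLin := by
    have h := LinearMap.finrank_range_add_finrank_ker (kronPencil n l).mulVecLin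
    rw [ker_kronPencil n hl, finrank_span_singleton (veroneseVec_ne_zero n hl)] at h
    rw [← LinearMap.range_eq_top]
    apply Submodule.eq_top_of_finrank_eq
    simpa using h
  refine dotProduct_eq_zero p fun w => ?_
  obtain ⟨q, rfl⟩ := hsurj w
  rw [mulVecLin_apply, dotProduct_mulVec, ← mulVec_transpose, hp, zero_dotProduct]

lemma linearIndependent_veroneseVec (n r : ℕ) (hr : r ≤ n + 1) (m : Fin r → ℝ × ℝ)
    (hm : ∀ s, m s ≠ 0)
    (hpair : ∀ s t, s ≠ t → (m s).1 * (m t).2 - (m s).2 * (m t).1 ≠ 0) :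
    LinearIndependent ℝ fun s => veroneseVec n (m s) := by
  induction n generalizing r with
  | zero =>
    have : Subsingleton (Fin r) := Fin.subsingleton_iff_le_one.2 hr
    exact (linearIndependent_subsingleton_index_iff _).2 fun s => veroneseVec_ne_zero 0 (hm s)
  | succ n ih =>
    cases r with
    | zero => exact linearIndependent_empty_type
    | succ r =>
      have hih := ih r (by omega) (fun s => m s.succ) (fun s => hm _)
        fun s t hst => hpair _ _ (by simpa using hst)
      rw [Fintype.linearIndependent_iff] at hih ⊢
      intro g hg
      have hT := congrArg (kronPencil (n + 1) (m 0)).mulVecLin hg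
      rw [Fin.sum_univ_succ, map_add, map_sum] at hT
      simp only [map_smul, mulVecLin_apply, kronPencil_mulVec_veroneseVec_self, smul_zero,
        kronPencil_mulVec_veroneseVec _ (m 0) (m (Fin.succ _)), map_zero, smul_smul,
        zero_add] at hT
      have hsucc : ∀ s : Fin r, g s.succ = 0 := fun s =>
        (mul_eq_zero.1 (hih _ hT s)).resolve_right (hpair _ _ (Fin.succ_ne_zero s).symm)
      have h0 : g 0 = 0 := by
        simpa [Fin.sum_univ_succ, hsucc, veroneseVec_ne_zero _ (hm 0)] using hg
      exact Fin.cases h0 hsucc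

lemma blockDiagonal'_mulVec_apply {o R : Type*} [Fintype o] [DecidableEq o]
    {m' n' : o → Type*} [∀ i, Fintype (n' i)] [NonUnitalNonAssocSemiring R]
    (M : ∀ i, Matrix (m' i) (n' i) R) (v : (Σ i, n' i) → R) (i : o) (x : m' i) :
    (blockDiagonal' M *ᵥ v) ⟨i, x⟩ = (M i *ᵥ fun y => v ⟨i, y⟩) x := by
  simp only [mulVec, dotProduct, Fintype.sum_sigma]
  rw [Finset.sum_eq_single i]
  · simp
  · intro j _ hj
    simp [blockDiagonal'_apply_ne _ _ _ hj.symm]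
  · simp

lemma blockPencil_eq (k : ℕ) (n : Fin k → ℕ) (l : ℝ × ℝ) :
    l.1 • blockC1 k n + l.2 • blockC2 k n =
      blockDiagonal' fun j => fromBlocks 0 (kronPencil (n j) l) (-(kronPencil (n j) l)ᵀ) 0 := by
  rw [blockC1, blockC2, ← blockDiagonal'_smul, ← blockDiagonal'_smul, ← blockDiagonal'_add]
  congr 1
  ext1 j
  simp only [Pi.add_apply, Pi.smul_apply, kronK1, kronK2, fromBlocks_smul, fromBlocks_add,
    kronPencil, transpose_add, transpose_smul, smul_zero, add_zero, smul_neg, neg_add]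

lemma mem_ker_blockPencil_iff (k : ℕ) (n : Fin k → ℕ) {l : ℝ × ℝ} (hl : l ≠ 0)
    (v : (Σ j : Fin k, Fin (n j) ⊕ Fin (n j + 1)) → ℝ) :
    v ∈ LinearMap.ker (l.1 • blockC1 k n + l.2 • blockC2 k n).mulVecLin ↔
      ∀ j, (∀ p, v ⟨j, Sum.inl p⟩ = 0) ∧
        (fun q => v ⟨j, Sum.inr q⟩) ∈ Submodule.span ℝ {veroneseVec (n j) l} := by
  rw [LinearMap.mem_ker, mulVecLin_apply, blockPencil_eq, funext_iff, Sigma.forall]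
  refine forall_congr' fun j => ?_
  simp only [blockDiagonal'_mulVec_apply, fromBlocks_mulVec, Sum.forall, Sum.elim_inl,
    Sum.elim_inr, zero_mulVec, zero_add, add_zero, neg_mulVec, Pi.neg_apply, Pi.zero_apply,
    neg_eq_zero, ← ker_kronPencil (n j) hl, LinearMap.mem_ker, mulVecLin_apply]
  rw [and_comm]
  refine and_congr ⟨fun h => ?_, fun h => ?_⟩ ?_
  · exact congrFun (kronPencil_transpose_mulVec_eq_zero (n j) hl (funext h))
  · have h0 : (fun y => v ⟨j, y⟩) ∘ Sum.inl = 0 := funext h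
    simp [h0]
  · exact funext_iff.symm

lemma uVec_inr (k : ℕ) (n : Fin k → ℕ) (j : Fin k) (l : ℝ × ℝ) (q : Fin (n j + 1)) :
    uVec k n j l ⟨j, Sum.inr q⟩ = veroneseVec (n j) l q := by
  simp [uVec]

lemma uVec_inl (k : ℕ) (n : Fin k → ℕ) (i j : Fin k) (l : ℝ × ℝ) (p : Fin (n i)) :
    uVec k n j l ⟨i, Sum.inl p⟩ = 0 := by
  simp [uVec]

lemma uVec_of_ne (k : ℕ) (n : Fin k → ℕ) {i j : Fin k} (h : i ≠ j) (l : ℝ × ℝ)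
    (x : Fin (n i) ⊕ Fin (n i + 1)) : uVec k n j l ⟨i, x⟩ = 0 := by
  simp [uVec, h]

lemma sum_smul_uVec_inr (k : ℕ) (n : Fin k → ℕ) (l : ℝ × ℝ) (c : Fin k → ℝ) (j : Fin k)
    (q : Fin (n j + 1)) :
    (∑ i, c i • uVec k n i l) ⟨j, Sum.inr q⟩ = c j * veroneseVec (n j) l q := by
  rw [Finset.sum_apply, Finset.sum_eq_single j]
  · simp [uVec_inr]
  · intro i _ hi
    simp [uVec_of_ne k n hi.symm]
  · simp

lemma linearIndependent_uVec (k : ℕ) (n : Fin k → ℕ) {l : ℝ × ℝ} (hl : l ≠ 0) :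
    LinearIndependent ℝ fun j : Fin k => uVec k n j l := by
  rw [Fintype.linearIndependent_iff]
  intro c hc j
  obtain ⟨q, hq⟩ := Function.ne_iff.1 (veroneseVec_ne_zero (n j) hl)
  have h := sum_smul_uVec_inr k n l c j q
  rw [hc] at h
  exact (mul_eq_zero.1 h.symm).resolve_right hq

lemma uVec_mem_ker (k : ℕ) (n : Fin k → ℕ) {l : ℝ × ℝ} (hl : l ≠ 0) (j : Fin k) :
    uVec k n j l ∈ LinearMap.ker (l.1 • blockC1 k n + l.2 • blockC2 k n).mulVecLin := by
  rw [mem_ker_blockPencil_iff k n hl]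
  refine fun i => ⟨uVec_inl k n i j l, ?_⟩
  by_cases h : i = j
  · subst h
    simp only [uVec_inr]
    exact Submodule.mem_span_singleton_self _
  · simp only [uVec_of_ne k n h]
    exact Submodule.zero_mem _

lemma exists_eq_sum_uVec_of_mem_ker (k : ℕ) (n : Fin k → ℕ) {l : ℝ × ℝ} (hl : l ≠ 0)
    {v : (Σ j : Fin k, Fin (n j) ⊕ Fin (n j + 1)) → ℝ}
    (hv : v ∈ LinearMap.ker (l.1 • blockC1 k n + l.2 • blockC2 k n).mulVecLin) :
    ∃ c : Fin k → ℝ, v = ∑ j, c j • uVec k n j l := by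
  rw [mem_ker_blockPencil_iff k n hl] at hv
  choose c hc using fun j => Submodule.mem_span_singleton.1 (hv j).2
  refine ⟨c, ?_⟩
  ext ⟨j, p | q⟩
  · simp [(hv j).1 p, uVec_inl]
  · rw [sum_smul_uVec_inr]
    exact (congrFun (hc j) q).symm

lemma ker_blockPencil (k : ℕ) (n : Fin k → ℕ) {l : ℝ × ℝ} (hl : l ≠ 0) :
    LinearMap.ker (l.1 • blockC1 k n + l.2 • blockC2 k n).mulVecLin =
      Submodule.span ℝ (Set.range fun j : Fin k => uVec k n j l) := by
  apply le_antisymm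
  · intro v hv
    obtain ⟨c, rfl⟩ := exists_eq_sum_uVec_of_mem_ker k n hl hv
    exact Submodule.sum_smul_mem _ _ fun j _ => Submodule.subset_span ⟨j, rfl⟩
  · rw [Submodule.span_le]
    rintro _ ⟨j, rfl⟩
    exact uVec_mem_ker k n hl j

lemma uVec_mem_blockQ (k : ℕ) (n : Fin k → ℕ) (j : Fin k) (l : ℝ × ℝ) :
    uVec k n j l ∈ blockQ k n j := by
  have h : uVec k n j l = ∑ q : Fin (n j + 1), veroneseVec (n j) l q •
      Pi.single (⟨j, Sum.inr q⟩ : Σ j' : Fin k, Fin (n j') ⊕ Fin (n j' + 1)) (1 : ℝ) := by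
    ext ⟨i, x⟩
    by_cases hi : i = j
    · subst hi
      rcases x with p | q <;> simp [uVec, Pi.single_apply]
    · simp [uVec_of_ne k n hi, hi]
  rw [h]
  exact Submodule.sum_smul_mem _ _ fun q _ => Submodule.subset_span ⟨q, rfl⟩

lemma apply_eq_zero_of_mem_blockF (k : ℕ) (n : Fin k → ℕ) {i j : Fin k} (hij : j < i)
    {v : (Σ j : Fin k, Fin (n j) ⊕ Fin (n j + 1)) → ℝ} (hv : v ∈ blockF k n j)
    (x : Fin (n i) ⊕ Fin (n i + 1)) : v ⟨i, x⟩ = 0 := by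
  suffices h : blockF k n j ≤ LinearMap.ker (LinearMap.proj (R := ℝ)
      (φ := fun _ : Σ j : Fin k, Fin (n j) ⊕ Fin (n j + 1) => ℝ) ⟨i, x⟩) from h hv
  refine iSup₂_le fun j' hj' => ?_
  rw [blockQ, Submodule.span_le]
  rintro _ ⟨q, rfl⟩
  have hne : i ≠ j' := (hj'.trans_lt hij).ne'
  simp [hne]

lemma blockF_inf_ker_blockPencil (k : ℕ) (n : Fin k → ℕ) {l : ℝ × ℝ} (hl : l ≠ 0) (j : Fin k) :
    blockF k n j ⊓ LinearMap.ker (l.1 • blockC1 k n + l.2 • blockC2 k n).mulVecLin =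
      Submodule.span ℝ ((fun j' : Fin k => uVec k n j' l) '' {j' | j' ≤ j}) := by
  apply le_antisymm
  · rintro v ⟨hF, hker⟩
    obtain ⟨c, rfl⟩ := exists_eq_sum_uVec_of_mem_ker k n hl hker
    refine Submodule.sum_mem _ fun i _ => ?_
    by_cases hi : i ≤ j
    · exact Submodule.smul_mem _ _ (Submodule.subset_span ⟨i, hi, rfl⟩)
    · obtain ⟨q, hq⟩ := Function.ne_iff.1 (veroneseVec_ne_zero (n i) hl)
      have h := apply_eq_zero_of_mem_blockF k n (not_le.1 hi) hF (Sum.inr q)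
      rw [sum_smul_uVec_inr] at h
      rw [(mul_eq_zero.1 h).resolve_right hq, zero_smul]
      exact Submodule.zero_mem _
  · rw [Submodule.span_le]
    rintro _ ⟨i, hi, rfl⟩
    exact ⟨Submodule.mem_iSup_of_mem i (Submodule.mem_iSup_of_mem hi (uVec_mem_blockQ k n i l)),
      uVec_mem_ker k n hl i⟩

lemma projQ_uVec_self (k : ℕ) (n : Fin k → ℕ) (j : Fin k) (l : ℝ × ℝ) :
    projQ k n j (uVec k n j l) = uVec k n j l := by
  ext ⟨i, p | q⟩ <;> by_cases h : i = j <;> simp [projQ, uVec, h]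

lemma projQ_uVec_of_ne (k : ℕ) (n : Fin k → ℕ) {i j : Fin k} (h : i ≠ j) (l : ℝ × ℝ) :
    projQ k n j (uVec k n i l) = 0 := by
  ext ⟨a, x⟩
  by_cases ha : a = j
  · subst ha
    simp [projQ, uVec_of_ne k n h.symm]
  · simp [projQ, ha]

lemma map_projQ_span_uVec (k : ℕ) (n : Fin k → ℕ) (l : ℝ × ℝ) (j : Fin k) :
    Submodule.map (projQ k n j)
        (Submodule.span ℝ ((fun j' : Fin k => uVec k n j' l) '' {j' | j' ≤ j})) =
      Submodule.span ℝ {uVec k n j l} := by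
  rw [Submodule.map_span]
  apply le_antisymm
  · rw [Submodule.span_le]
    rintro _ ⟨_, ⟨i, -, rfl⟩, rfl⟩
    by_cases h : i = j
    · subst h
      simp only [projQ_uVec_self]
      exact Submodule.mem_span_singleton_self _
    · simp only [projQ_uVec_of_ne k n h]
      exact Submodule.zero_mem _
  · rw [Submodule.span_singleton_le_iff_mem]
    exact Submodule.subset_span ⟨_, ⟨j, le_refl j, rfl⟩, projQ_uVec_self k n j l⟩

/-- Corollary 3.4 of the paper: for every nonzero `λ`, the kernel of `C_λ` is
`k`-dimensional and spanned by `u_1(λ),…,u_k(λ)`; `F_j ∩ ker C_λ` is `j`-dimensional and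
spanned by `u_1(λ),…,u_j(λ)`; its projection onto `Q_j` is the line spanned by `u_j(λ)`; and
the vectors `u_j(λ^(1)),…,u_j(λ^(r))` at `r ≤ n_j+1` pairwise non-proportional parameters are
linearly independent (so `λ ↦ span{u_j(λ)}` is a Veronese inclusion into `ℙ(Q_j)`). -/
theorem block_kernel_veronese (k : ℕ) (hk : 1 ≤ k) (n : Fin k → ℕ) (hmono : StrictMono n) :
    (∀ l : ℝ × ℝ, l ≠ 0 →
      (LinearMap.ker (l.1 • blockC1 k n + l.2 • blockC2 k n).mulVecLin =
          Submodule.span ℝ (Set.range fun j : Fin k => uVec k n j l) ∧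
        Module.finrank ℝ
          (LinearMap.ker (l.1 • blockC1 k n + l.2 • blockC2 k n).mulVecLin) = k) ∧
      (∀ j : Fin k,
        blockF k n j ⊓ LinearMap.ker (l.1 • blockC1 k n + l.2 • blockC2 k n).mulVecLin =
          Submodule.span ℝ ((fun j' : Fin k => uVec k n j' l) '' {j' | j' ≤ j}) ∧
        Module.finrank ℝ
          (blockF k n j ⊓
            LinearMap.ker (l.1 • blockC1 k n + l.2 • blockC2 k n).mulVecLin :
              Submodule ℝ _) = (j : ℕ) + 1) ∧
      (∀ j : Fin k,
        Submodule.map (projQ k n j)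
            (blockF k n j ⊓ LinearMap.ker (l.1 • blockC1 k n + l.2 • blockC2 k n).mulVecLin) =
          Submodule.span ℝ {uVec k n j l})) ∧
    (∀ j : Fin k, ∀ r : ℕ, r ≤ n j + 1 → ∀ m : Fin r → ℝ × ℝ, (∀ s, m s ≠ 0) →
      (∀ s t, s ≠ t → (m s).1 * (m t).2 - (m s).2 * (m t).1 ≠ 0) →
      LinearIndependent ℝ (fun s => uVec k n j (m s))) := by
  refine ⟨fun l hl => ⟨⟨ker_blockPencil k n hl, ?_⟩, fun j =>
    ⟨blockF_inf_ker_blockPencil k n hl j, ?_⟩, fun j => ?_⟩, fun j r hr m hm hpair => ?_⟩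
  · rw [ker_blockPencil k n hl, finrank_span_eq_card (linearIndependent_uVec k n hl),
      Fintype.card_fin]
  · rw [blockF_inf_ker_blockPencil k n hl j, Set.image_eq_range]
    refine (finrank_span_eq_card
      ((linearIndependent_uVec k n hl).comp _ Subtype.val_injective)).trans ?_
    rw [← Nat.card_eq_fintype_card]
    change Nat.card (Set.Iic j) = (j : ℕ) + 1
    rw [Nat.card_eq_fintype_card, Fintype.card_Iic, Fin.card_Iic]
  · rw [blockF_inf_ker_blockPencil k n hl j, map_projQ_span_uVec]
  · refine LinearIndependent.of_comp
      (LinearMap.funLeft ℝ ℝ fun q : Fin (n j + 1) =>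
        (⟨j, Sum.inr q⟩ : Σ j' : Fin k, Fin (n j') ⊕ Fin (n j' + 1))) ?_
    convert linearIndependent_veroneseVec (n j) r hr m hm hpair using 1
    ext s q
    exact uVec_inr k n j (m s) q

end
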